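/- For all m ≥ 1, all i ∈ {1, …, r}, and all k ∈ B^i_m, the m-shift satisfies γ^k_∞(σ^m) = γ^i_∞. Consequently, the sets B¹_m, …, B^r_m are pairwise disjoint. -/

import Mathlib

open MeasureTheory Filter

namespace PomdpPaper

/-- A belief (probability vector) on `Fin n`. -/
def IsBelief {n : ℕ} (p : Fin n → ℝ) : Prop :=
  (∀ k, 0 ≤ p k) ∧ ∑ k, p k = 1

/-- The measure on a finite type associated with a probability vector. -/
noncomputable def vecMeasure {α : Type*} [Fintype α] [MeasurableSpace α] (p : α → ℝ) :
    Measure α :=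
  ∑ x : α, ENNReal.ofReal (p x) • Measure.dirac x

/-- The Dirac belief at a point. -/
def diracBelief {n : ℕ} (k : Fin n) : Fin n → ℝ := fun k' => if k' = k then 1 else 0

/-- The `i`-th binary digit of a real number `x ∈ [0,1)` (as a real number `0` or `1`). -/
noncomputable def digitR (x : ℝ) (i : ℕ) : ℝ :=
  if ⌊x * 2 ^ (i + 1)⌋ % 2 = 1 then 1 else 0

/-- From one uniform seed `x ∈ [0,1)`, a sequence `unif x 0, unif x 1, …` of
(independent, uniformly distributed on `[0,1]`) real numbers, obtained by splitting the
binary digits of `x` along the pairing function. -/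
noncomputable def unif (x : ℝ) (m : ℕ) : ℝ :=
  ∑' j : ℕ, digitR x (Nat.pair m j) / 2 ^ (j + 1)

open Classical in
/-- Inverse-transform sampling from a probability vector on `Fin n` using a seed `u ∈ [0,1]`. -/
noncomputable def sampleFin {n : ℕ} (hn : 0 < n) (p : Fin n → ℝ) (u : ℝ) : Fin n :=
  let s : Finset (Fin n) :=
    Finset.univ.filter fun y : Fin n => u < ∑ z ∈ Finset.univ.filter fun z : Fin n => z ≤ y, p z
  if hs : s.Nonempty then s.min' hs else ⟨0, hn⟩

/-- Inverse-transform sampling from a probability vector on a finite nonempty type. -/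
noncomputable def sampleOn {β : Type*} [Fintype β] [Nonempty β] (p : β → ℝ) (u : ℝ) : β :=
  (Fintype.equivFin β).symm
    (sampleFin Fintype.card_pos (fun i => p ((Fintype.equivFin β).symm i)) u)

/-- A POMDP with states `Fin nK`, actions `Fin nA`, signals `Fin nS`, transition function `q`
and reward function `g` with values in `[0,1]`. -/
structure POMDP where
  nK : ℕ
  nA : ℕ
  nS : ℕ
  hK : 0 < nK
  hA : 0 < nA
  hS : 0 < nS
  q : Fin nK → Fin nA → Fin nK × Fin nS → ℝ
  q_nonneg : ∀ k a y, 0 ≤ q k a y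
  q_sum : ∀ k a, ∑ y, q k a y = 1
  g : Fin nK → Fin nA → ℝ
  g_nonneg : ∀ k a, 0 ≤ g k a
  g_le_one : ∀ k a, g k a ≤ 1

namespace POMDP

variable (Γ : POMDP)

/-- The state space. -/
abbrev K := Fin Γ.nK
/-- The action space. -/
abbrev A := Fin Γ.nA
/-- The signal space. -/
abbrev S := Fin Γ.nS

instance : Nonempty Γ.K := ⟨⟨0, Γ.hK⟩⟩
instance : Nonempty Γ.A := ⟨⟨0, Γ.hA⟩⟩
instance : Nonempty Γ.S := ⟨⟨0, Γ.hS⟩⟩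

/-- A history: the finite sequence of past actions and signals. -/
abbrev Hist := List (Γ.A × Γ.S)

/-- A (pure) strategy: a map from histories to actions. -/
abbrev Strategy := Γ.Hist → Γ.A

/-- The sample space carrying all the randomness: an initial state together with a
uniform seed in `[0,1)` used to draw all the transitions. -/
abbrev Env := Γ.K × ℝ

/-- The probability measure on the sample space induced by the initial belief `p1`:
the initial state is drawn according to `p1`, the seed uniformly on `[0,1)`. -/
noncomputable def envMeasure (p1 : Γ.K → ℝ) : Measure Γ.Env :=
  (vecMeasure p1).prod (volume.restrict (Set.Ico (0 : ℝ) 1))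

/-- The trajectory: `(Γ.traj σ ω m).1` is the state `k_{m+1}` at stage `m+1` and
`(Γ.traj σ ω m).2` is the history before stage `m+1` (of length `m`), when the
decision-maker uses strategy `σ` and the randomness is `ω`.  At each stage, the pair
(new state, signal) is drawn from `q` via inverse-transform sampling from a fresh
uniform variable. -/
noncomputable def traj (σ : Γ.Strategy) (ω : Γ.Env) : ℕ → Γ.K × Γ.Hist
  | 0 => (ω.1, [])
  | m + 1 =>
    let p := traj σ ω m
    let a := σ p.2
    let y := sampleOn (Γ.q p.1 a) (unif ω.2 m)
    (y.1, p.2 ++ [(a, y.2)])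

/-- The state `k_{m+1}` at stage `m+1` (`m` is 0-indexed). -/
noncomputable def state (σ : Γ.Strategy) (ω : Γ.Env) (m : ℕ) : Γ.K := (Γ.traj σ ω m).1

/-- The history before stage `m+1` (a list of length `m`). -/
noncomputable def hist (σ : Γ.Strategy) (ω : Γ.Env) (m : ℕ) : Γ.Hist := (Γ.traj σ ω m).2

/-- The action `a_{m+1}` played at stage `m+1`. -/
noncomputable def act (σ : Γ.Strategy) (ω : Γ.Env) (m : ℕ) : Γ.A := σ (Γ.hist σ ω m)

/-- The reward `g_{m+1}` obtained at stage `m+1`. -/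
noncomputable def rew (σ : Γ.Strategy) (ω : Γ.Env) (m : ℕ) : ℝ :=
  Γ.g (Γ.state σ ω m) (Γ.act σ ω m)

/-- The average reward over the first `n` stages. -/
noncomputable def avg (σ : Γ.Strategy) (ω : Γ.Env) (n : ℕ) : ℝ :=
  (1 / n : ℝ) * ∑ m ∈ Finset.range n, Γ.rew σ ω m

/-- The probability of an event under initial belief `p1` (the strategy `σ` is recorded for
readability; the underlying measure does not depend on it). -/
noncomputable def prob (p1 : Γ.K → ℝ) (_σ : Γ.Strategy) (E : Set Γ.Env) : ℝ :=
  (Γ.envMeasure p1 E).toReal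

/-- The long-run average payoff `γ^{p1}_∞(σ) = E[liminf (1/n) ∑ g_m]`. -/
noncomputable def pay (p1 : Γ.K → ℝ) (σ : Γ.Strategy) : ℝ :=
  ∫ ω, atTop.liminf (Γ.avg σ ω) ∂(Γ.envMeasure p1)

/-- The payoff starting from a deterministic state `k`, i.e. `γ^k_∞(σ)`. -/
noncomputable def payK (k : Γ.K) (σ : Γ.Strategy) : ℝ := Γ.pay (diracBelief k) σ

/-- The value `v_∞(p1)`. -/
noncomputable def val (p1 : Γ.K → ℝ) : ℝ := ⨆ σ : Γ.Strategy, Γ.pay p1 σ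

/-- A strategy has finite memory if it is implemented by a finite-state transducer. -/
def FiniteMemory (σ : Γ.Strategy) : Prop :=
  ∃ (n : ℕ) (m0 : Fin n) (σa : Fin n → Γ.A) (σu : Fin n → Γ.A × Γ.S → Fin n),
    ∀ h : Γ.Hist, σ h = σa (h.foldl σu m0)

/-- A blind MDP: the signal set is a singleton. -/
def Blind : Prop := Γ.nS = 1

/-- The strategy induced by a sequence of actions `a_1, a_2, …` (`as m` is the action played
at stage `m+1`, regardless of the observed history). -/
def blindStrat (as : ℕ → Γ.A) : Γ.Strategy := fun h => as h.length

end POMDP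

/-- A sequence is eventually periodic if it is periodic with some period `T ≥ 1` from
some stage `N` on. -/
def EventuallyPeriodic {α : Type*} (as : ℕ → α) : Prop :=
  ∃ T ≥ 1, ∃ N ≥ 1, ∀ m ≥ N, as (m + T) = as m


namespace POMDP

variable (Γ : POMDP)

/-- `Γ.stateProb k σ m k'` is the probability that the state at stage `m + 1` is `k'`,
starting from state `k` and playing `σ`. -/
noncomputable def stateProb (k : Γ.K) (σ : Γ.Strategy) (m : ℕ) (k' : Γ.K) : ℝ :=
  Γ.prob (diracBelief k) σ {ω | Γ.state σ ω m = k'}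

/-- The super-support at stage `m + 1` associated with the classes `Kc`:
`Γ.superSupp as Kc m i` is the set of states reached with positive probability at stage
`m + 1` under the blind strategy `as`, starting from a state in `Kc i`. -/
noncomputable def superSupp (as : ℕ → Γ.A) {r : ℕ} (Kc : Fin r → Finset Γ.K)
    (m : ℕ) (i : Fin r) : Set Γ.K :=
  {k' | ∃ k ∈ Kc i, 0 < Γ.stateProb k (Γ.blindStrat as) m k'}

end POMDP

/-- The `m`-shift of a sequence of actions. -/
def shiftSeq {α : Type*} (as : ℕ → α) (m : ℕ) : ℕ → α := fun t => as (m + t)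

/-- Uniform measure on the unit interval. -/
noncomputable def lamU : Measure ℝ := volume.restrict (Set.Ico (0 : ℝ) 1)

instance : IsProbabilityMeasure lamU := ⟨by simp [lamU]⟩

/-- Boolean binary digits. -/
noncomputable def digB (x : ℝ) (i : ℕ) : Bool := decide (⌊x * 2 ^ (i + 1)⌋ % 2 = 1)

/-- Fair coin. -/
noncomputable def coin : Measure Bool :=
  (2⁻¹ : ENNReal) • Measure.dirac false + (2⁻¹ : ENNReal) • Measure.dirac true

instance : IsProbabilityMeasure coin := ⟨by simp [coin, ENNReal.inv_two_add_inv_two]⟩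

/-- Law of a fair coin sequence. -/
noncomputable def coins : Measure (ℕ → Bool) := Measure.infinitePi (fun _ => coin)

instance : IsProbabilityMeasure coins := by unfold coins; infer_instance

lemma digB_measurable : Measurable digB := by
  refine measurable_pi_lambda _ fun i => ?_
  have h : Measurable fun x : ℝ => ⌊x * 2 ^ (i + 1)⌋ := by fun_prop
  exact (measurable_of_countable (fun z : ℤ => decide (z % 2 = 1))).comp h

lemma lamU_self {S : Set ℝ} (hS : MeasurableSet S) :
    lamU S = 2⁻¹ * lamU ((fun y => y / 2) ⁻¹' S) + 2⁻¹ * lamU ((fun y => (y + 1) / 2) ⁻¹' S) := by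
  have e1 : (fun y : ℝ => y / 2) ⁻¹' S ∩ Set.Ico 0 1
      = (fun y : ℝ => y * 2⁻¹) ⁻¹' (S ∩ Set.Ico 0 (1/2)) := by
    ext y
    simp only [Set.mem_inter_iff, Set.mem_preimage, Set.mem_Ico, div_eq_mul_inv]
    constructor
    · rintro ⟨h, h1, h2⟩; exact ⟨h, by linarith, by linarith⟩
    · rintro ⟨h, h1, h2⟩; exact ⟨h, by linarith, by linarith⟩
  have e2 : (fun y : ℝ => (y + 1) / 2) ⁻¹' S ∩ Set.Ico 0 1
      = (fun y : ℝ => y + 1) ⁻¹' ((fun y : ℝ => y * 2⁻¹) ⁻¹' (S ∩ Set.Ico (1/2) 1)) := by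
    ext y
    simp only [Set.mem_inter_iff, Set.mem_preimage, Set.mem_Ico, div_eq_mul_inv]
    constructor
    · rintro ⟨h, h1, h2⟩; exact ⟨h, by linarith, by linarith⟩
    · rintro ⟨h, h1, h2⟩; exact ⟨h, by linarith, by linarith⟩
  have e3 : S ∩ Set.Ico 0 1 = (S ∩ Set.Ico 0 (1/2)) ∪ (S ∩ Set.Ico (1/2 : ℝ) 1) := by
    rw [← Set.inter_union_distrib_left, Set.Ico_union_Ico_eq_Ico (by norm_num) (by norm_num)]
  have hd : Disjoint (S ∩ Set.Ico (0:ℝ) (1/2)) (S ∩ Set.Ico (1/2 : ℝ) 1) := by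
    rw [Set.disjoint_left]
    rintro x ⟨_, h1⟩ ⟨_, h2⟩
    exact absurd h1.2 (not_lt.2 h2.1)
  have hc : ∀ a : ENNReal, 2⁻¹ * (2 * a) = a := fun a => by
    rw [← mul_assoc, ENNReal.inv_mul_cancel (by simp) (by simp), one_mul]
  unfold lamU
  rw [Measure.restrict_apply hS, Measure.restrict_apply (by measurability),
    Measure.restrict_apply (by measurability), e1, e2, e3,
    measure_union hd (hS.inter measurableSet_Ico), measure_preimage_add_right,
    Real.volume_preimage_mul_right (by norm_num), Real.volume_preimage_mul_right (by norm_num)]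
  simp [hc]

lemma lamU_ae_mem : ∀ᵐ y ∂lamU, y ∈ Set.Ico (0:ℝ) 1 := ae_restrict_mem measurableSet_Ico

lemma digB_shift0 (y : ℝ) (i : ℕ) : digB (y / 2) (i + 1) = digB y i := by
  unfold digB
  have : y / 2 * 2 ^ (i + 1 + 1) = y * 2 ^ (i + 1) := by ring
  rw [this]

lemma digB_shift1 (y : ℝ) (i : ℕ) : digB ((y + 1) / 2) (i + 1) = digB y i := by
  unfold digB
  have : (y + 1) / 2 * 2 ^ (i + 1 + 1) = y * 2 ^ (i + 1) + ((2 * 2 ^ i : ℤ) : ℝ) := by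
    push_cast; ring
  rw [this, Int.floor_add_intCast, Int.add_mul_emod_self_left]

lemma digB_zero0 {y : ℝ} (hy : y ∈ Set.Ico (0:ℝ) 1) : digB (y / 2) 0 = false := by
  unfold digB
  have : ⌊y / 2 * 2 ^ (0 + 1)⌋ = 0 := by
    rw [Int.floor_eq_iff]; constructor <;> norm_num <;> linarith [hy.1, hy.2]
  rw [this]; simp

lemma digB_zero1 {y : ℝ} (hy : y ∈ Set.Ico (0:ℝ) 1) : digB ((y + 1) / 2) 0 = true := by
  unfold digB
  have : ⌊(y + 1) / 2 * 2 ^ (0 + 1)⌋ = 1 := by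
    rw [Int.floor_eq_iff]; constructor <;> norm_num <;> linarith [hy.1, hy.2]
  rw [this]; simp

lemma digB_box (N : ℕ) : ∀ t : ℕ → Set Bool,
    lamU {x | ∀ i < N, digB x i ∈ t i} = ∏ i ∈ Finset.range N, coin (t i) := by
  induction N with
  | zero => intro t; simp
  | succ N ih =>
    intro t
    have hm : ∀ (M : ℕ) (t : ℕ → Set Bool), MeasurableSet {x | ∀ i < M, digB x i ∈ t i} := by
      intro M t
      have : {x | ∀ i < M, digB x i ∈ t i} = ⋂ i, ⋂ (_ : i < M), (fun x => digB x i) ⁻¹' t i := by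
        ext; simp
      rw [this]
      exact MeasurableSet.iInter fun i => MeasurableSet.iInter fun _ =>
        ((measurable_pi_apply i).comp digB_measurable) (MeasurableSet.of_discrete)
    have h := ih (fun i => t (i + 1))
    rw [lamU_self (hm _ _), Finset.prod_range_succ', ← h]
    have a0 : lamU ((fun y => y / 2) ⁻¹' {x | ∀ i < N + 1, digB x i ∈ t i})
        = lamU {x | false ∈ t 0 ∧ ∀ i < N, digB x i ∈ t (i + 1)} := by
      apply measure_congr
      filter_upwards [lamU_ae_mem] with y hy
      apply propext
      change (∀ i < N + 1, digB (y / 2) i ∈ t i) ↔ (false ∈ t 0 ∧ ∀ i < N, digB y i ∈ t (i + 1))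
      rw [Nat.forall_lt_succ_left, digB_zero0 hy]
      simp only [digB_shift0]
    have a1 : lamU ((fun y => (y + 1) / 2) ⁻¹' {x | ∀ i < N + 1, digB x i ∈ t i})
        = lamU {x | true ∈ t 0 ∧ ∀ i < N, digB x i ∈ t (i + 1)} := by
      apply measure_congr
      filter_upwards [lamU_ae_mem] with y hy
      apply propext
      change (∀ i < N + 1, digB ((y + 1) / 2) i ∈ t i) ↔
        (true ∈ t 0 ∧ ∀ i < N, digB y i ∈ t (i + 1))
      rw [Nat.forall_lt_succ_left, digB_zero1 hy]
      simp only [digB_shift1]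
    rw [a0, a1]
    by_cases h0 : false ∈ t 0 <;> by_cases h1 : true ∈ t 0 <;>
      simp [h0, h1, coin, ENNReal.inv_two_add_inv_two, mul_comm]
    rw [← add_mul, ENNReal.inv_two_add_inv_two, one_mul]

lemma map_digB : lamU.map digB = coins := by
  refine Measure.eq_infinitePi _ fun s t ht => ?_
  rw [Measure.map_apply digB_measurable (MeasurableSet.pi s.countable_toSet fun i _ => ht i)]
  classical
  obtain ⟨N, hN⟩ : ∃ N, ∀ i ∈ s, i < N := ⟨s.sup id + 1, fun i hi =>
    Nat.lt_succ_of_le (Finset.le_sup (f := id) hi)⟩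
  have h := digB_box N (fun i => if i ∈ s then t i else Set.univ)
  have e : digB ⁻¹' (Set.pi s t) = {x | ∀ i < N, digB x i ∈ (if i ∈ s then t i else Set.univ)} := by
    ext x
    simp only [Set.mem_preimage, Set.mem_pi, Set.mem_ofPred_eq, Finset.mem_coe]
    constructor
    · intro hx i _
      split_ifs with his
      · exact hx i his
      · trivial
    · intro hx i hi
      have := hx i (hN i hi)
      rwa [if_pos hi] at this
  rw [e, h]
  symm
  rw [← Finset.prod_subset (s₁ := s) (fun i hi => Finset.mem_range.2 (hN i hi))]
  · exact Finset.prod_congr rfl fun i hi => by rw [if_pos hi]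
  · intro i _ hi; rw [if_neg hi]; exact measure_univ

/-- Glue two coin sequences along the blocks. -/
def glue (m : ℕ) (p : (ℕ → Bool) × (ℕ → Bool)) (n : ℕ) : Bool :=
  if n.unpair.1 < m then p.1 n else p.2 (Nat.pair (n.unpair.1 - m) n.unpair.2)

lemma glue_measurable (m : ℕ) : Measurable (glue m) := by
  refine measurable_pi_lambda _ fun n => ?_
  unfold glue
  split_ifs <;> fun_prop

lemma map_glue (m : ℕ) : (coins.prod coins).map (glue m) = coins := by
  refine Measure.eq_infinitePi _ fun s t ht => ?_
  rw [Measure.map_apply (glue_measurable m) (MeasurableSet.pi s.countable_toSet fun i _ => ht i)]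
  classical
  let f : ℕ → ℕ := fun n => Nat.pair (n.unpair.1 - m) n.unpair.2
  let f' : ℕ → ℕ := fun n => Nat.pair (n.unpair.1 + m) n.unpair.2
  have hff : ∀ n, ¬ n.unpair.1 < m → f' (f n) = n := by
    intro n hn
    simp only [f, f', Nat.unpair_pair]
    rw [Nat.sub_add_cancel (not_lt.1 hn), Nat.pair_unpair]
  set s1 := s.filter fun n => n.unpair.1 < m with hs1
  set s2 := s.filter fun n => ¬ n.unpair.1 < m with hs2
  have e : glue m ⁻¹' (Set.pi s t)
      = (Set.pi s1 t) ×ˢ (Set.pi (s2.image f) (fun n => t (f' n))) := by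
    ext ⟨a, b⟩
    simp only [Set.mem_preimage, Set.mem_pi, Set.mem_prod, Finset.mem_coe, hs1, hs2,
      Finset.mem_filter, Finset.mem_image]
    constructor
    · intro h
      refine ⟨fun n hn => ?_, ?_⟩
      · have := h n hn.1
        simpa [glue, hn.2] using this
      · rintro _ ⟨n, ⟨hn, hn2⟩, rfl⟩
        have := h n hn
        rw [hff n hn2]
        simpa [glue, hn2, f] using this
    · rintro ⟨h1, h2⟩ n hn
      by_cases hn2 : n.unpair.1 < m
      · simpa [glue, hn2] using h1 n ⟨hn, hn2⟩
      · have := h2 _ ⟨n, ⟨hn, hn2⟩, rfl⟩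
        rw [hff n hn2] at this
        simpa [glue, hn2, f] using this
  rw [e, Measure.prod_prod]
  unfold coins
  rw [Measure.infinitePi_pi _ (fun i _ => ht i), Measure.infinitePi_pi _ (fun i _ => ht _),
    Finset.prod_image]
  · rw [← Finset.prod_filter_mul_prod_filter_not s (fun n => n.unpair.1 < m)]
    congr 1
    refine Finset.prod_congr rfl fun n hn => ?_
    rw [hff n (Finset.mem_filter.1 hn).2]
  · intro x hx y hy hxy
    have hx2 := (Finset.mem_filter.1 hx).2
    have hy2 := (Finset.mem_filter.1 hy).2
    rw [← hff x hx2, ← hff y hy2, hxy]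

/-- Uniform variables from coin sequences. -/
noncomputable def unifB (d : ℕ → Bool) (m : ℕ) : ℝ :=
  ∑' j : ℕ, (if d (Nat.pair m j) = true then (1:ℝ) else 0) / 2 ^ (j + 1)

lemma unif_eq (x : ℝ) : unif x = unifB (digB x) := by
  funext m
  simp [unif, unifB, digitR, digB]

lemma unifB_measurable : Measurable unifB := by
  refine measurable_pi_lambda _ fun m => ?_
  have : (fun d => unifB d m) = fun d : ℕ → Bool =>
      ((∑' j : ℕ, (if d (Nat.pair m j) = true then (1:NNReal) else 0) / 2 ^ (j + 1) : NNReal) : ℝ) := by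
    funext d
    rw [NNReal.coe_tsum, unifB]
    refine tsum_congr fun j => ?_
    split_ifs <;> simp
  rw [this]
  refine measurable_coe_nnreal_real.comp (Measurable.nnreal_tsum fun j => ?_)
  exact (measurable_of_countable
    (fun b : Bool => (if b = true then (1:NNReal) else 0) / 2 ^ (j + 1))).comp
    (measurable_pi_apply (Nat.pair m j))

lemma unifB_glue_lt {m i : ℕ} (h : i < m) (d e : ℕ → Bool) :
    unifB (glue m (d, e)) i = unifB d i := by
  simp [unifB, glue, h]

lemma unifB_glue_ge (m i : ℕ) (d e : ℕ → Bool) :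
    unifB (glue m (d, e)) (m + i) = unifB e i := by
  simp [unifB, glue]

lemma sampleFin_measurable {n : ℕ} (hn : 0 < n) (p : Fin n → ℝ) :
    Measurable (sampleFin hn p) := by
  classical
  let F : (Fin n → Prop) → Fin n := fun P =>
    if hs : (Finset.univ.filter fun y => P y).Nonempty then
      (Finset.univ.filter fun y => P y).min' hs else ⟨0, hn⟩
  have hF : sampleFin hn p = F ∘ (fun u y =>
      u < ∑ z ∈ Finset.univ.filter fun z : Fin n => z ≤ y, p z) := by
    funext u
    simp only [sampleFin, F, Function.comp]
  rw [hF]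
  refine (measurable_of_countable F).comp (measurable_pi_lambda _ fun y => ?_)
  exact measurableSet_setOfPred.1 measurableSet_Iio

lemma sampleOn_measurable {β : Type*} [Fintype β] [Nonempty β] [MeasurableSpace β]
    (p : β → ℝ) : Measurable (sampleOn p) :=
  (measurable_of_countable _).comp (sampleFin_measurable _ _)

namespace POMDP

variable (Γ : POMDP)

/-- State process driven by a sequence of uniforms. -/
noncomputable def st (as : ℕ → Γ.A) (k : Γ.K) (u : ℕ → ℝ) : ℕ → Γ.K
  | 0 => k
  | m + 1 => (sampleOn (Γ.q (st as k u m) (as m)) (u m)).1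

/-- Average reward of the process `st`. -/
noncomputable def avV (as : ℕ → Γ.A) (k : Γ.K) (u : ℕ → ℝ) (n : ℕ) : ℝ :=
  (1 / n : ℝ) * ∑ m ∈ Finset.range n, Γ.g (Γ.st as k u m) (as m)

lemma hist_length (as : ℕ → Γ.A) (ω : Γ.Env) (m : ℕ) :
    (Γ.traj (Γ.blindStrat as) ω m).2.length = m := by
  induction m with
  | zero => rfl
  | succ m ih => simp [traj, ih]

lemma state_eq (as : ℕ → Γ.A) (k : Γ.K) (x : ℝ) (m : ℕ) :
    Γ.state (Γ.blindStrat as) (k, x) m = Γ.st as k (unif x) m := by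
  induction m with
  | zero => rfl
  | succ m ih =>
    have : Γ.state (Γ.blindStrat as) (k, x) (m + 1) =
      (sampleOn (Γ.q (Γ.state (Γ.blindStrat as) (k, x) m)
        (as (Γ.traj (Γ.blindStrat as) (k, x) m).2.length)) (unif x m)).1 := rfl
    rw [this, ih, hist_length]
    rfl

lemma avg_eq (as : ℕ → Γ.A) (k : Γ.K) (x : ℝ) :
    Γ.avg (Γ.blindStrat as) (k, x) = Γ.avV as k (unif x) := by
  funext n
  unfold avg avV
  congr 1
  refine Finset.sum_congr rfl fun m _ => ?_
  have : Γ.rew (Γ.blindStrat as) (k, x) m = Γ.g (Γ.state (Γ.blindStrat as) (k, x) m)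
        (as (Γ.traj (Γ.blindStrat as) (k, x) m).2.length) := rfl
  rw [this, state_eq, hist_length]

lemma st_measurable (as : ℕ → Γ.A) (k : Γ.K) (m : ℕ) :
    Measurable fun u => Γ.st as k u m := by
  induction m with
  | zero => exact measurable_const
  | succ m ih =>
    have h : Measurable fun z : Γ.K × ℝ => (sampleOn (Γ.q z.1 (as m)) z.2).1 :=
      measurable_from_prod_countable_right fun k =>
        measurable_fst.comp (sampleOn_measurable (Γ.q k (as m)))
    have h2 : Measurable fun u : ℕ → ℝ => (Γ.st as k u m, u m) :=
      ih.prodMk (measurable_pi_apply m)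
    have h3 := h.comp h2
    simp only [st]
    exact h3

lemma avV_measurable (as : ℕ → Γ.A) (k : Γ.K) (n : ℕ) :
    Measurable fun u => Γ.avV as k u n := by
  unfold avV
  refine Measurable.const_mul (Finset.measurable_fun_sum _ fun m _ => ?_) _
  exact (measurable_of_countable (fun k => Γ.g k (as m))).comp (Γ.st_measurable as k m)

lemma st_congr (as : ℕ → Γ.A) (k : Γ.K) {u u' : ℕ → ℝ} (m : ℕ) (h : ∀ i < m, u i = u' i) :
    Γ.st as k u m = Γ.st as k u' m := by
  induction m with
  | zero => rfl
  | succ m ih =>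
    simp only [st]
    rw [ih fun i hi => h i (by omega), h m (by omega)]

lemma st_shift (as : ℕ → Γ.A) (k : Γ.K) (u : ℕ → ℝ) (m t : ℕ) :
    Γ.st as k u (m + t) = Γ.st (shiftSeq as m) (Γ.st as k u m) (fun i => u (m + i)) t := by
  induction t with
  | zero => rfl
  | succ t ih =>
    rw [← add_assoc]
    simp only [st]
    rw [ih]
    rfl

lemma env_dirac (k : Γ.K) : Γ.envMeasure (diracBelief k) = lamU.map (Prod.mk k) := by
  have : vecMeasure (diracBelief k) = Measure.dirac k := by
    unfold vecMeasure diracBelief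
    rw [Finset.sum_eq_single k]
    · simp
    · intro b _ hb; simp [hb]
    · simp
  unfold envMeasure
  rw [this, Measure.dirac_prod]
  rfl

lemma ae_env (k : Γ.K) (p : Γ.Env → Prop) :
    (∀ᵐ ω ∂(Γ.envMeasure (diracBelief k)), p ω) ↔ ∀ᵐ x ∂lamU, p (k, x) := by
  rw [env_dirac, (measurableEmbedding_prodMk_left k).ae_map_iff]

end POMDP

lemma cesaro_shift (f : ℕ → ℝ) (c : ℝ) (m : ℕ)
    (h : Tendsto (fun n : ℕ => (1 / n : ℝ) * ∑ i ∈ Finset.range n, f i) atTop (nhds c)) :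
    Tendsto (fun n : ℕ => (1 / n : ℝ) * ∑ i ∈ Finset.range n, f (m + i)) atTop (nhds c) := by
  have h1 := h.comp (tendsto_add_atTop_nat m)
  have h2 : Tendsto (fun n : ℕ => (1 / n : ℝ)) atTop (nhds 0) := tendsto_one_div_atTop_nhds_zero_nat
  have h3 : Tendsto (fun n : ℕ => (1 + (m : ℝ) * (1 / n : ℝ)) *
      ((1 / ((n + m : ℕ) : ℝ)) * ∑ i ∈ Finset.range (n + m), f i)
      - (1 / n : ℝ) * ∑ i ∈ Finset.range m, f i) atTop
      (nhds ((1 + (m : ℝ) * 0) * c - 0 * ∑ i ∈ Finset.range m, f i)) :=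
    (((h2.const_mul _).const_add _).mul h1).sub (h2.mul_const _)
  simp only [mul_zero, add_zero, one_mul, zero_mul, sub_zero] at h3
  refine h3.congr' ?_
  filter_upwards [eventually_gt_atTop 0] with n hn
  have hn' : (n : ℝ) ≠ 0 := by positivity
  have hnm : ((n : ℝ) + m) ≠ 0 := by positivity
  rw [add_comm n m, Finset.sum_range_add]
  push_cast
  rw [add_comm (m : ℝ) n]
  field_simp
  ring

lemma shift_ae (Γ : POMDP) (as : ℕ → Γ.A) (k k' : Γ.K) (c : ℝ) (m : ℕ)
    (h : ∀ᵐ ω ∂(Γ.envMeasure (diracBelief k)),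
        Tendsto (Γ.avg (Γ.blindStrat as) ω) atTop (nhds c))
    (hk : 0 < Γ.stateProb k (Γ.blindStrat as) m k') :
    ∀ᵐ ω ∂(Γ.envMeasure (diracBelief k')),
        Tendsto (Γ.avg (Γ.blindStrat (shiftSeq as m)) ω) atTop (nhds c) := by
  rw [POMDP.ae_env] at h ⊢
  simp only [POMDP.avg_eq, unif_eq] at h ⊢
  have h1 : ∀ᵐ d ∂coins, Tendsto (Γ.avV as k (unifB d)) atTop (nhds c) := by
    rw [← map_digB, ae_map_iff digB_measurable.aemeasurable]
    · exact h
    · exact measurableSet_tendsto (f := fun n d => Γ.avV as k (unifB d) n) (nhds c)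
        fun n => (Γ.avV_measurable as k n).comp unifB_measurable
  rw [← map_glue m] at h1
  have h2 := Measure.ae_ae_of_ae_prod (ae_of_ae_map (glue_measurable m).aemeasurable h1)
  have h3 : ∃ᵐ d ∂coins, Γ.st as k (unifB d) m = k' := by
    intro hn
    rw [← map_digB] at hn
    have hn2 := ae_of_ae_map digB_measurable.aemeasurable hn
    have hn3 : ∀ᵐ ω ∂(Γ.envMeasure (diracBelief k)), ¬ Γ.state (Γ.blindStrat as) ω m = k' := by
      rw [POMDP.ae_env]
      simpa only [POMDP.state_eq, unif_eq] using hn2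
    have h0 : Γ.envMeasure (diracBelief k) {ω | Γ.state (Γ.blindStrat as) ω m = k'} = 0 := by
      simpa [ae_iff] using hn3
    simp [POMDP.stateProb, POMDP.prob, h0] at hk
  obtain ⟨d, hd, hd2⟩ := (h3.and_eventually h2).exists
  have h4 : ∀ᵐ e ∂coins, Tendsto (Γ.avV (shiftSeq as m) k' (unifB e)) atTop (nhds c) := by
    filter_upwards [hd2] with e he
    have := cesaro_shift (fun i => Γ.g (Γ.st as k (unifB (glue m (d, e))) i) (as i)) c m he
    refine this.congr fun n => ?_
    unfold POMDP.avV
    congr 1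
    refine Finset.sum_congr rfl fun i _ => ?_
    rw [POMDP.st_shift, Γ.st_congr as k m (fun i hi => unifB_glue_lt hi d e), hd]
    simp only [unifB_glue_ge]
    rfl
  rw [← map_digB] at h4
  exact ae_of_ae_map digB_measurable.aemeasurable h4

lemma shift_pay (Γ : POMDP) (as : ℕ → Γ.A) (k : Γ.K) (c : ℝ)
    (h : ∀ᵐ ω ∂(Γ.envMeasure (diracBelief k)),
        Tendsto (Γ.avg (Γ.blindStrat as) ω) atTop (nhds c)) :
    Γ.payK k (Γ.blindStrat as) = c := by
  have : IsProbabilityMeasure (Γ.envMeasure (diracBelief k)) := by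
    rw [POMDP.env_dirac]
    exact Measure.isProbabilityMeasure_map measurable_prodMk_left.aemeasurable
  unfold POMDP.payK POMDP.pay
  rw [integral_congr_ae (g := fun _ => c)]
  · simp
  · filter_upwards [h] with ω hω using hω.liminf_eq

/-- **Lemma 3.** For all `m ≥ 1`, `i` and `k ∈ B^i_m`, the `m`-shift of `σ` satisfies
`γ^k_∞(σ^m) = γ^i_∞`; consequently the sets `B^1_m, …, B^r_m` are pairwise disjoint.
(Stages are 0-indexed: `m : ℕ` here corresponds to stage `m + 1` in the paper.) -/
theorem blind_superSupp_shift_payoff (Γ : POMDP) (hΓ : Γ.Blind)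
    (pstar : Γ.K → ℝ) (hps : IsBelief pstar) (as : ℕ → Γ.A)
    (herg : ∀ k, 0 < pstar k →
      ∀ᵐ ω ∂(Γ.envMeasure (diracBelief k)),
        Tendsto (Γ.avg (Γ.blindStrat as) ω) atTop (nhds (Γ.payK k (Γ.blindStrat as))))
    (r : ℕ) (Kc : Fin r → Finset Γ.K) (γv : Fin r → ℝ)
    (hKc : ∀ k, 0 < pstar k ↔ ∃ i, k ∈ Kc i)
    (hcl : ∀ i, ∀ k ∈ Kc i, Γ.payK k (Γ.blindStrat as) = γv i)
    (hdist : ∀ i j, i ≠ j → γv i ≠ γv j)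
    (hne : ∀ i, (Kc i).Nonempty)
    (m : ℕ) :
    (∀ i, ∀ k' ∈ Γ.superSupp as Kc m i,
      Γ.payK k' (Γ.blindStrat (shiftSeq as m)) = γv i) ∧
    (∀ i j, i ≠ j →
      Disjoint (Γ.superSupp as Kc m i) (Γ.superSupp as Kc m j)) := by
  have main : ∀ i, ∀ k' ∈ Γ.superSupp as Kc m i,
      Γ.payK k' (Γ.blindStrat (shiftSeq as m)) = γv i := by
    rintro i k' ⟨k, hk, hpos⟩
    have h := herg k ((hKc k).2 ⟨i, hk⟩)
    rw [hcl i k hk] at h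
    exact shift_pay Γ _ k' _ (shift_ae Γ as k k' _ m h hpos)
  refine ⟨main, fun i j hij => ?_⟩
  rw [Set.disjoint_left]
  intro k' h1 h2
  exact hdist i j hij ((main i k' h1).symm.trans (main j k' h2))

end PomdpPaper
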